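/- Recurrence for the factorial Littlewood-Richardson coefficients: Let n ≥ 1, let θ be a skew diagram, and let μ ⊊ ν be partitions with at most n parts. Define c^σ_{θτ}(a,b) = Σ_{ρ : τ ⊆ ρ ⊆ σ} s_θ(a_ρ|b)·H(τ,ρ)·H'(ρ,σ) for partitions τ ⊆ σ with at most n parts. Then (|a_ν| − |a_μ|)·c^ν_{θμ}(a,b) = Σ_{μ' : μ → μ', μ' ⊆ ν} c^ν_{θμ'}(a,b) − Σ_{ν' : ν' → ν, μ ⊆ ν'} c^{ν'}_{θμ}(a,b), in ℚ(a_i : i ∈ ℤ)[b_i : i ∈ ℤ]. -/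

import Mathlib

open scoped BigOperators

namespace FactorialLR

/-- The cells of the skew diagram `θo / θi`. -/
def skewCells (θi θo : YoungDiagram) : Finset (ℕ × ℕ) :=
  θo.cells \ θi.cells

/-- A filling of the cell set `s` with entries in `Fin n` (`0`-based, representing the
`1`-based entries `{1,…,n}`) is semistandard if it weakly increases along rows and strictly
increases down columns. -/
def IsSsyt {n : ℕ} (s : Finset (ℕ × ℕ)) (T : s → Fin n) : Prop :=
  (∀ c c' : s, (c : ℕ × ℕ).1 = (c' : ℕ × ℕ).1 → (c : ℕ × ℕ).2 ≤ (c' : ℕ × ℕ).2 → T c ≤ T c') ∧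
  (∀ c c' : s, (c : ℕ × ℕ).1 < (c' : ℕ × ℕ).1 → (c : ℕ × ℕ).2 = (c' : ℕ × ℕ).2 → T c < T c')

/-- The factorial Schur-type polynomial attached to a (possibly skew) cell set `s`:
`Σ_T ∏_{α ∈ s} (x_{T(α)} − a_{T(α)+c(α)})`, where `T` runs over semistandard fillings of `s`
with entries in `{1,…,n}` (stored `0`-based) and `c(α) = j − i` is the content of `α = (i,j)`.
Taking `a = 0` gives the ordinary Schur polynomial. -/
noncomputable def sgen {A : Type} [CommRing A] (n : ℕ) (s : Finset (ℕ × ℕ))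
    (x : Fin n → A) (a : ℤ → A) : A :=
  ∑ᶠ T ∈ {T : s → Fin n | IsSsyt s T},
    ∏ c : s, (x (T c) - a ((T c : ℤ) + 1 + ((c : ℕ × ℕ).2 : ℤ) - ((c : ℕ × ℕ).1 : ℤ)))

/-- The `n`-tuple `a_ρ = (a_{ρ_1+n}, a_{ρ_2+n-1}, …, a_{ρ_n+1})`; the `i`-th entry
(`0`-based `i`) is `a_{ρ_{i+1}+n-(i+1)+1}`. -/
noncomputable def subA {A : Type} [CommRing A] (n : ℕ) (a : ℤ → A) (ρ : YoungDiagram) :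
    Fin n → A :=
  fun i => a ((ρ.rowLen i : ℤ) + (n : ℤ) - (i : ℤ))

/-- `|a_ρ| = a_{ρ_1+n} + ⋯ + a_{ρ_n+1}`. -/
noncomputable def aNorm {A : Type} [CommRing A] (n : ℕ) (a : ℤ → A) (ρ : YoungDiagram) : A :=
  ∑ i : Fin n, subA n a ρ i

/-- `μ → ν` : `ν` is obtained from `μ` by adding a single cell. -/
def Covers (μ ν : YoungDiagram) : Prop :=
  μ ≤ ν ∧ ν.card = μ.card + 1

/-- Chains `μ = ρ⁽⁰⁾ → ρ⁽¹⁾ → ⋯ → ρ⁽ˡ⁾ = ν` of Young diagrams, encoded as lists. -/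
def chainSet (μ ν : YoungDiagram) : Set (List YoungDiagram) :=
  {L | L.Chain' Covers ∧ L.head? = some μ ∧ L.getLast? = some ν}

/-- `H(μ,ρ)`: the sum over all chains `μ = ρ⁽⁰⁾ → ⋯ → ρ⁽ʳ⁾ = ρ` of
`∏_{i=0}^{r-1} 1/(|a_ρ| − |a_{ρ⁽ⁱ⁾}|)`; in particular `H(μ,μ) = 1`. -/
noncomputable def H {K : Type} [Field K] (n : ℕ) (a : ℤ → K) (μ ρ : YoungDiagram) : K :=
  ∑ᶠ L ∈ chainSet μ ρ,
    (L.dropLast.map fun σ => (aNorm n a ρ - aNorm n a σ)⁻¹).prod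

/-- `H'(ρ,ν)`: the sum over all chains `ρ = ρ⁽ʳ⁾ → ⋯ → ρ⁽ˡ⁾ = ν` of
`∏_{i=r+1}^{l} 1/(|a_ρ| − |a_{ρ⁽ⁱ⁾}|)`; in particular `H'(ρ,ρ) = 1`. -/
noncomputable def H' {K : Type} [Field K] (n : ℕ) (a : ℤ → K) (ρ ν : YoungDiagram) : K :=
  ∑ᶠ L ∈ chainSet ρ ν,
    (L.tail.map fun σ => (aNorm n a ρ - aNorm n a σ)⁻¹).prod

/-- The field `ℚ(a_i : i ∈ ℤ)` of rational functions in the variables `a_i`, `i ∈ ℤ`. -/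
noncomputable abbrev Kfield : Type := FractionRing (MvPolynomial ℤ ℚ)

/-- The variables `a_i`, `i ∈ ℤ`, as elements of `Kfield`. -/
noncomputable def aK : ℤ → Kfield :=
  fun k => algebraMap (MvPolynomial ℤ ℚ) Kfield (MvPolynomial.X k)

/-- `c^σ_{θτ}(a,b) = Σ_{τ ⊆ ρ ⊆ σ} s_θ(a_ρ|b)·H(τ,ρ)·H'(ρ,σ)`, an element of
`ℚ(a_i)[b_i : i ∈ ℤ]`. -/
noncomputable def ccoef (n : ℕ) (θi θo tau sigma : YoungDiagram) :
    MvPolynomial ℤ Kfield :=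
  ∑ᶠ rho ∈ {rho : YoungDiagram | tau ≤ rho ∧ rho ≤ sigma},
    sgen n (skewCells θi θo)
        (subA n (fun k => (MvPolynomial.C (aK k) : MvPolynomial ℤ Kfield)) rho)
        (fun k => MvPolynomial.X k) *
      MvPolynomial.C (H n aK tau rho * H' n aK rho sigma)

lemma finite_Iic_yd (ν : YoungDiagram) : {ρ : YoungDiagram | ρ ≤ ν}.Finite := by
  apply Set.Finite.of_finite_image (f := YoungDiagram.cells)
  · apply (ν.cells.powerset.finite_toSet).subset
    rintro _ ⟨ρ, hρ, rfl⟩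
    simp only [Finset.coe_powerset, Set.mem_preimage, Set.mem_powerset_iff, Finset.coe_subset]
    exact YoungDiagram.cells_subset_iff.2 hρ
  · intro x _ y _ h
    exact YoungDiagram.ext h

lemma chainSet_le : ∀ (L : List YoungDiagram) (μ ρ : YoungDiagram),
    L ∈ chainSet μ ρ → μ ≤ ρ := by
  intro L
  induction L with
  | nil => rintro μ ρ ⟨_, h, _⟩; simp at h
  | cons x L ih =>
    rintro μ ρ ⟨hc, hh, hl⟩
    simp only [List.head?_cons, Option.some.injEq] at hh
    subst hh
    cases L with
    | nil => simp at hl; exact hl.le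
    | cons y L =>
      have hc' := List.isChain_cons_cons.1 hc
      exact hc'.1.1.trans (ih y ρ ⟨hc'.2, by simp, by simpa using hl⟩)

lemma chainSet_self (μ : YoungDiagram) : chainSet μ μ = {[μ]} := by
  ext L
  constructor
  · intro h
    match L, h with
    | [], ⟨_, h, _⟩ => simp at h
    | [x], ⟨_, h, _⟩ => simpa using h
    | x :: y :: L, ⟨hc, hh, hl⟩ =>
      exfalso
      have hc' := List.isChain_cons_cons.1 hc
      have h1 : y ≤ μ := chainSet_le (y :: L) y μ ⟨hc'.2, by simp, by simpa using hl⟩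
      simp only [List.head?_cons, Option.some.injEq] at hh
      subst hh
      have h2 := Finset.card_le_card (YoungDiagram.cells_subset_iff.2 h1)
      have h3 := hc'.1.2
      simp only [YoungDiagram.card] at h3
      omega
  · rintro rfl
    exact ⟨List.isChain_singleton _, by simp, by simp⟩

lemma chainSet_cons (μ ρ ν : YoungDiagram) (hne : μ ≠ ρ) (hρ : ρ ≤ ν) :
    chainSet μ ρ = ⋃ μ' ∈ {μ' : YoungDiagram | Covers μ μ' ∧ μ' ≤ ν},
      (fun L => μ :: L) '' chainSet μ' ρ := by
  ext L
  simp only [Set.mem_iUnion, Set.mem_image, Set.mem_setOf_eq, exists_prop]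
  constructor
  · intro h
    match L, h with
    | [], ⟨_, h, _⟩ => simp at h
    | [x], ⟨_, h, h'⟩ =>
      simp at h h'
      exact absurd (h.symm.trans h') hne
    | x :: y :: L, ⟨hc, hh, hl⟩ =>
      have hc' := List.isChain_cons_cons.1 hc
      simp only [List.head?_cons, Option.some.injEq] at hh
      subst hh
      have hm : y :: L ∈ chainSet y ρ := ⟨hc'.2, by simp, by simpa using hl⟩
      exact ⟨y, ⟨hc'.1, (chainSet_le _ _ _ hm).trans hρ⟩, y :: L, hm, rfl⟩
  · rintro ⟨μ', ⟨hcov, _⟩, L, h, rfl⟩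
    match L, h with
    | [], ⟨_, h, _⟩ => simp at h
    | y :: L, ⟨hc, hh, hl⟩ =>
      simp only [List.head?_cons, Option.some.injEq] at hh
      subst hh
      exact ⟨List.isChain_cons_cons.2 ⟨hcov, hc⟩, by simp, by simpa using hl⟩

lemma chainSet_snoc (ρ ν μ : YoungDiagram) (hne : ρ ≠ ν) (hρ : μ ≤ ρ) :
    chainSet ρ ν = ⋃ ν' ∈ {ν' : YoungDiagram | Covers ν' ν ∧ μ ≤ ν'},
      (fun L => L ++ [ν]) '' chainSet ρ ν' := by
  ext L
  simp only [Set.mem_iUnion, Set.mem_image, Set.mem_setOf_eq, exists_prop]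
  constructor
  · rintro ⟨hc, hh, hl⟩
    obtain ⟨L', rfl⟩ := List.getLast?_eq_some_iff.1 hl
    rcases List.eq_nil_or_concat' L' with rfl | ⟨M, z, rfl⟩
    · simp at hh
      exact absurd hh.symm hne
    · have hc2 := List.isChain_append.1 hc
      have hm : M ++ [z] ∈ chainSet ρ z := by
        refine ⟨hc2.1, ?_, by simp⟩
        simpa using hh
      exact ⟨z, ⟨hc2.2.2 z (by simp) ν (by simp), hρ.trans (chainSet_le _ _ _ hm)⟩, _, hm, rfl⟩
  · rintro ⟨ν', ⟨hcov, _⟩, L, ⟨hc, hh, hl⟩, rfl⟩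
    refine ⟨List.isChain_append.2 ⟨hc, List.isChain_singleton _, ?_⟩, ?_, by simp⟩
    · intro x hx y hy
      rw [hl] at hx
      simp at hx hy
      subst hx; subst hy; exact hcov
    · simp [hh]

lemma finite_up (μ ν : YoungDiagram) : {μ' : YoungDiagram | Covers μ μ' ∧ μ' ≤ ν}.Finite :=
  (finite_Iic_yd ν).subset fun _ h => h.2

lemma finite_down (μ ν : YoungDiagram) : {ν' : YoungDiagram | Covers ν' ν ∧ μ ≤ ν'}.Finite :=
  (finite_Iic_yd ν).subset fun _ h => h.1.1

lemma chainSet_finite (k : ℕ) : ∀ μ ρ : YoungDiagram, ρ.card ≤ μ.card + k →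
    (chainSet μ ρ).Finite := by
  induction k with
  | zero =>
    intro μ ρ h
    by_cases hne : μ = ρ
    · subst hne; rw [chainSet_self]; exact Set.finite_singleton _
    · convert Set.finite_empty
      ext L
      simp only [Set.mem_empty_iff_false, iff_false]
      intro hL
      have hle := chainSet_le _ _ _ hL
      exact hne (YoungDiagram.ext (Finset.eq_of_subset_of_card_le
        (YoungDiagram.cells_subset_iff.2 hle) (by simpa using h)))
  | succ k ih =>
    intro μ ρ h
    by_cases hne : μ = ρ
    · subst hne; rw [chainSet_self]; exact Set.finite_singleton _
    · rw [chainSet_cons μ ρ ρ hne le_rfl]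
      refine (finite_up μ ρ).biUnion fun μ' hμ' => (ih μ' ρ ?_).image _
      have := hμ'.1.2
      omega

lemma chainSet_fin (μ ρ : YoungDiagram) : (chainSet μ ρ).Finite :=
  chainSet_finite ρ.card μ ρ (by omega)

lemma chainSet_eq_empty {μ ρ : YoungDiagram} (h : ¬ μ ≤ ρ) : chainSet μ ρ = ∅ := by
  ext L
  simp only [Set.mem_empty_iff_false, iff_false]
  exact fun hL => h (chainSet_le _ _ _ hL)

lemma H_zero {K : Type} [Field K] (n : ℕ) (a : ℤ → K) {μ ρ : YoungDiagram} (h : ¬ μ ≤ ρ) :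
    H n a μ ρ = 0 := by
  simp [H, chainSet_eq_empty h]

lemma H'_zero {K : Type} [Field K] (n : ℕ) (a : ℤ → K) {μ ρ : YoungDiagram} (h : ¬ μ ≤ ρ) :
    H' n a μ ρ = 0 := by
  simp [H', chainSet_eq_empty h]

lemma Covers.not_le {μ ν : YoungDiagram} (h : Covers μ ν) : ¬ ν ≤ μ := by
  intro h1
  have h2 := Finset.card_le_card (YoungDiagram.cells_subset_iff.2 h1)
  have h3 := h.2
  simp only [YoungDiagram.card] at h3
  omega

lemma H_rec {K : Type} [Field K] (n : ℕ) (a : ℤ → K) (μ ρ ν : YoungDiagram) (hρ : ρ ≤ ν)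
    (hinj : μ ≠ ρ → aNorm n a ρ - aNorm n a μ ≠ 0) :
    (aNorm n a ρ - aNorm n a μ) * H n a μ ρ =
      ∑ μ' ∈ (finite_up μ ν).toFinset, H n a μ' ρ := by
  by_cases hne : μ = ρ
  · subst hne
    rw [sub_self, zero_mul, Finset.sum_eq_zero]
    intro x hx
    simp only [Set.Finite.mem_toFinset, Set.mem_setOf_eq] at hx
    exact H_zero n a hx.1.not_le
  · have h0 := hinj hne
    rw [H, chainSet_cons μ ρ ν hne hρ, finsum_mem_biUnion _ (finite_up μ ν)
      (fun μ' _ => (chainSet_fin μ' ρ).image _),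
      finsum_mem_eq_finite_toFinset_sum _ (finite_up μ ν), Finset.mul_sum]
    · refine Finset.sum_congr rfl fun μ' _ => ?_
      rw [finsum_mem_image (by intro x _ y _ h; simpa using h), H,
        mul_finsum_mem' _ _ (chainSet_fin μ' ρ)]
      refine finsum_mem_congr rfl fun L hL => ?_
      obtain ⟨y, L', rfl⟩ : ∃ y L', L = y :: L' := by
        cases L with
        | nil => simpa using hL.2.1
        | cons y L' => exact ⟨y, L', rfl⟩
      rw [List.dropLast_cons₂, List.map_cons, List.prod_cons, mul_inv_cancel_left₀ h0]
    · intro x _ y _ hxy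
      rw [Function.onFun, Set.disjoint_left]
      rintro _ ⟨L, hL, rfl⟩ ⟨L', hL', h⟩
      simp only [List.cons.injEq, true_and] at h
      subst h
      have := hL.2.1.symm.trans hL'.2.1
      exact hxy (by simpa using this)

lemma H'_rec {K : Type} [Field K] (n : ℕ) (a : ℤ → K) (μ ρ ν : YoungDiagram) (hρ : μ ≤ ρ)
    (hinj : ρ ≠ ν → aNorm n a ρ - aNorm n a ν ≠ 0) :
    (aNorm n a ρ - aNorm n a ν) * H' n a ρ ν =
      ∑ ν' ∈ (finite_down μ ν).toFinset, H' n a ρ ν' := by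
  by_cases hne : ρ = ν
  · subst hne
    rw [sub_self, zero_mul, Finset.sum_eq_zero]
    intro x hx
    simp only [Set.Finite.mem_toFinset, Set.mem_setOf_eq] at hx
    exact H'_zero n a hx.1.not_le
  · have h0 := hinj hne
    rw [H', chainSet_snoc ρ ν μ hne hρ, finsum_mem_biUnion _ (finite_down μ ν)
      (fun ν' _ => (chainSet_fin ρ ν').image _),
      finsum_mem_eq_finite_toFinset_sum _ (finite_down μ ν), Finset.mul_sum]
    · refine Finset.sum_congr rfl fun ν' _ => ?_
      rw [finsum_mem_image (by intro x _ y _ h; simpa using h), H',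
        mul_finsum_mem' _ _ (chainSet_fin ρ ν')]
      refine finsum_mem_congr rfl fun L hL => ?_
      obtain ⟨y, L', rfl⟩ : ∃ y L', L = y :: L' := by
        cases L with
        | nil => simpa using hL.2.1
        | cons y L' => exact ⟨y, L', rfl⟩
      simp only [List.cons_append, List.tail_cons, List.map_append, List.prod_append,
        List.map_cons, List.map_nil, List.prod_cons, List.prod_nil, mul_one]
      rw [mul_comm, mul_assoc, inv_mul_cancel₀ h0, mul_one]
    · intro x _ y _ hxy
      rw [Function.onFun, Set.disjoint_left]
      rintro _ ⟨L, hL, rfl⟩ ⟨L', hL', h⟩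
      simp only [List.append_cancel_right_eq] at h
      subst h
      have := hL.2.2.symm.trans hL'.2.2
      exact hxy (by simpa using this)

lemma aNorm_ne (n : ℕ) {μ ρ : YoungDiagram} (hle : μ ≤ ρ) (hne : μ ≠ ρ)
    (hρ : ρ.colLen 0 ≤ n) : aNorm n aK ρ ≠ aNorm n aK μ := by
  intro h
  have key : ∀ σ : YoungDiagram, aNorm n aK σ = algebraMap (MvPolynomial ℤ ℚ) Kfield
      (∑ i : Fin n, MvPolynomial.X ((σ.rowLen i : ℤ) + (n : ℤ) - (i : ℤ))) := by
    intro σ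
    simp only [aNorm, subA, aK, map_sum]
  rw [key, key] at h
  have h1 := IsFractionRing.injective (MvPolynomial ℤ ℚ) Kfield h
  have h2 := congrArg (MvPolynomial.eval (fun k : ℤ => (k : ℚ))) h1
  simp only [map_sum, MvPolynomial.eval_X] at h2
  have hrow : ∀ i, μ.rowLen i ≤ ρ.rowLen i := by
    intro i
    by_contra hc
    push Not at hc
    have h3 : (i, ρ.rowLen i) ∈ μ := YoungDiagram.mem_iff_lt_rowLen.2 hc
    have h4 : (i, ρ.rowLen i) ∈ ρ := hle h3
    exact lt_irrefl _ (YoungDiagram.mem_iff_lt_rowLen.1 h4)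
  obtain ⟨⟨i, j⟩, hc, hc'⟩ : ∃ c, c ∈ ρ ∧ c ∉ μ := by
    by_contra hcon
    push Not at hcon
    exact hne (le_antisymm hle hcon)
  have hi : i < n := by
    have h5 : (i, 0) ∈ ρ := ρ.up_left_mem le_rfl (Nat.zero_le j) hc
    exact (YoungDiagram.mem_iff_lt_colLen.1 h5).trans_le hρ
  rw [YoungDiagram.mem_iff_lt_rowLen] at hc hc'
  have := Finset.sum_lt_sum (s := (Finset.univ : Finset (Fin n)))
    (f := fun i : Fin n => ((((μ.rowLen i : ℤ) + (n : ℤ) - (i : ℤ) : ℤ)) : ℚ))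
    (g := fun i : Fin n => ((((ρ.rowLen i : ℤ) + (n : ℤ) - (i : ℤ) : ℤ)) : ℚ))
    (fun k _ => by
      have := hrow k
      apply Int.cast_le.2
      omega)
    ⟨⟨i, hi⟩, Finset.mem_univ _, by
      apply Int.cast_lt.2
      simp only
      omega⟩
  exact this.ne' h2

lemma finite_Icc_yd (μ ν : YoungDiagram) : {ρ : YoungDiagram | μ ≤ ρ ∧ ρ ≤ ν}.Finite :=
  (finite_Iic_yd ν).subset fun _ h => h.2

lemma ccoef_eq (n : ℕ) (θi θo μ ν τ σ : YoungDiagram) (hτ : μ ≤ τ) (hσ : σ ≤ ν) :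
    ccoef n θi θo τ σ = ∑ rho ∈ (finite_Icc_yd μ ν).toFinset,
      sgen n (skewCells θi θo)
        (subA n (fun k => (MvPolynomial.C (aK k) : MvPolynomial ℤ Kfield)) rho)
        (fun k => MvPolynomial.X k) *
      MvPolynomial.C (H n aK τ rho * H' n aK rho σ) := by
  rw [ccoef, finsum_mem_eq_finite_toFinset_sum _ (finite_Icc_yd τ σ)]
  apply Finset.sum_subset
  · intro x hx
    simp only [Set.Finite.mem_toFinset, Set.mem_setOf_eq] at hx ⊢
    exact ⟨hτ.trans hx.1, hx.2.trans hσ⟩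
  · intro x _ hx
    simp only [Set.Finite.mem_toFinset, Set.mem_setOf_eq, not_and_or] at hx
    rcases hx with hx | hx
    · simp [H_zero n aK hx]
    · simp [H'_zero n aK hx]

/-- **Recurrence for the factorial Littlewood–Richardson coefficients.**
`(|a_ν| − |a_μ|)·c^ν_{θμ}(a,b) = Σ_{μ → μ' ⊆ ν} c^ν_{θμ'}(a,b) − Σ_{μ ⊆ ν' → ν} c^{ν'}_{θμ}(a,b)`. -/
theorem ccoef_recurrence (n : ℕ) (hn : 1 ≤ n) (θi θo : YoungDiagram) (hθ : θi ≤ θo)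
    (mu nu : YoungDiagram) (hmu : mu.colLen 0 ≤ n) (hnu : nu.colLen 0 ≤ n)
    (hsub : mu ≤ nu) (hne : mu ≠ nu) :
    MvPolynomial.C (aNorm n aK nu - aNorm n aK mu) * ccoef n θi θo mu nu =
      (∑ᶠ mu' ∈ {mu' : YoungDiagram | Covers mu mu' ∧ mu' ≤ nu}, ccoef n θi θo mu' nu) -
      ∑ᶠ nu' ∈ {nu' : YoungDiagram | Covers nu' nu ∧ mu ≤ nu'}, ccoef n θi θo mu nu' := by
  have up : ∀ x ∈ (finite_up mu nu).toFinset, mu ≤ x := by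
    intro x hx
    simp only [Set.Finite.mem_toFinset, Set.mem_setOf_eq] at hx
    exact hx.1.1
  have down : ∀ x ∈ (finite_down mu nu).toFinset, x ≤ nu := by
    intro x hx
    simp only [Set.Finite.mem_toFinset, Set.mem_setOf_eq] at hx
    exact hx.1.1
  rw [finsum_mem_eq_finite_toFinset_sum _ (finite_up mu nu),
    finsum_mem_eq_finite_toFinset_sum _ (finite_down mu nu),
    Finset.sum_congr rfl fun x hx => ccoef_eq n θi θo mu nu x nu (up x hx) le_rfl,
    Finset.sum_congr rfl fun x hx => ccoef_eq n θi θo mu nu mu x le_rfl (down x hx),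
    ccoef_eq n θi θo mu nu mu nu le_rfl le_rfl,
    Finset.sum_comm, Finset.sum_comm (s := (finite_down mu nu).toFinset),
    ← Finset.sum_sub_distrib, Finset.mul_sum]
  refine Finset.sum_congr rfl fun ρ hρ => ?_
  simp only [Set.Finite.mem_toFinset, Set.mem_setOf_eq] at hρ
  have hcol : ρ.colLen 0 ≤ n := by
    by_contra hc
    push Not at hc
    have h1 : (n, 0) ∈ ρ := YoungDiagram.mem_iff_lt_colLen.2 hc
    have h2 : (n, 0) ∈ nu := hρ.2 h1
    exact absurd (YoungDiagram.mem_iff_lt_colLen.1 h2) (not_lt.2 hnu)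
  have e1 := H_rec n aK mu ρ nu hρ.2 fun h => sub_ne_zero.2 (aNorm_ne n hρ.1 h hcol)
  have e2 := H'_rec n aK mu ρ nu hρ.1 fun h => sub_ne_zero.2 (aNorm_ne n hρ.2 h hnu).symm
  rw [← Finset.mul_sum, ← Finset.mul_sum, ← mul_sub, ← map_sum, ← map_sum, ← map_sub,
    ← Finset.sum_mul, ← Finset.mul_sum, ← e1, ← e2, mul_left_comm, ← map_mul]
  congr 2
  ring

end FactorialLR
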